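/- Let Ĉ_Borel(ℓ,0) be the image of C_Borel(ℓ,0) under the quotient map B(ℓ) → B(ℓ)/U(ℓ), and let Ĉ'_Borel(ℓ,0) be the image of C_Borel(ℓ,0) under the quotient map B(ℓ) → B(ℓ)/U'(ℓ). Then (ℓ − 1) · |Ĉ'_Borel(ℓ,0)| = |Ĉ_Borel(ℓ,0)|, and consequently |Ĉ'_Borel(ℓ,0)| ≤ 2(ℓ − 1)^{g−1}. -/

import Mathlib

open Matrix Polynomial

abbrev GL2 (ℓ : ℕ) := Matrix.GeneralLinearGroup (Fin 2) (ZMod ℓ)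

/-- The matrix of entries of an element of `GL₂(ℤ/ℓℤ)`. -/
abbrev mat {ℓ : ℕ} (M : GL2 ℓ) : Matrix (Fin 2) (Fin 2) (ZMod ℓ) := (M : Matrix (Fin 2) (Fin 2) (ZMod ℓ))

/-- Upper triangular. -/
def IsUpper {ℓ : ℕ} (M : GL2 ℓ) : Prop := mat M 1 0 = 0

/-- Upper triangular with both diagonal entries equal to 1. -/
def IsUnip {ℓ : ℕ} (M : GL2 ℓ) : Prop := mat M 1 0 = 0 ∧ mat M 0 0 = 1 ∧ mat M 1 1 = 1

/-- Diagonal. -/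
def IsDiagMat {ℓ : ℕ} (M : GL2 ℓ) : Prop := mat M 1 0 = 0 ∧ mat M 0 1 = 0

/-- Membership in `G(ℓ)`: all determinants agree. -/
def MemG {ℓ g : ℕ} (M : Fin g → GL2 ℓ) : Prop := ∀ i j, (mat (M i)).det = (mat (M j)).det

def MemB {ℓ g : ℕ} (M : Fin g → GL2 ℓ) : Prop := (∀ i, IsUpper (M i)) ∧ MemG M

def MemU {ℓ g : ℕ} (M : Fin g → GL2 ℓ) : Prop := ∀ i, IsUnip (M i)

def MemU' {ℓ g : ℕ} (M : Fin g → GL2 ℓ) : Prop :=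
  ∃ (lam : (ZMod ℓ)ˣ) (N : Fin g → GL2 ℓ), MemU N ∧
    ∀ i, mat (M i) = (lam : ZMod ℓ) • mat (N i)

def MemT {ℓ g : ℕ} (M : Fin g → GL2 ℓ) : Prop := (∀ i, IsDiagMat (M i)) ∧ MemG M

/-- Sum of traces of the components. -/
def traceSum {ℓ g : ℕ} (M : Fin g → GL2 ℓ) : ZMod ℓ := ∑ i, (mat (M i)).trace

/-- The characteristic polynomial of each component splits into linear factors over `ℤ/ℓℤ`. -/
def SplitCharpoly {ℓ g : ℕ} (M : Fin g → GL2 ℓ) : Prop :=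
  ∀ i, ∃ a b : ZMod ℓ, (mat (M i)).charpoly = (X - C a) * (X - C b)

/-- Membership in `C(ℓ,t)`. -/
def MemC {ℓ g : ℕ} (t : ℤ) (M : Fin g → GL2 ℓ) : Prop :=
  MemG M ∧ SplitCharpoly M ∧ traceSum M = ((-t : ℤ) : ZMod ℓ)

/-- `B(ℓ)` as a subgroup of `GL₂(ℤ/ℓℤ)^g`. -/
def Bsub (ℓ g : ℕ) : Subgroup (Fin g → GL2 ℓ) where
  carrier := {M | MemB M}
  one_mem' := by
    refine ⟨fun i => ?_, fun i j => rfl⟩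
    show ((1 : GL2 ℓ) : Matrix (Fin 2) (Fin 2) (ZMod ℓ)) 1 0 = 0
    simp [Matrix.one_apply]
  mul_mem' := by
    rintro M N ⟨hMu, hMd⟩ ⟨hNu, hNd⟩
    refine ⟨fun i => ?_, fun i j => ?_⟩
    · show ((M i * N i : GL2 ℓ) : Matrix (Fin 2) (Fin 2) (ZMod ℓ)) 1 0 = 0
      have h1 := hMu i
      have h2 := hNu i
      unfold IsUpper at h1 h2
      rw [Units.val_mul, Matrix.mul_apply, Fin.sum_univ_two]
      simp [mat] at h1 h2
      simp [h1, h2]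
    · show (mat (M i * N i)).det = (mat (M j * N j)).det
      simp only [mat, Units.val_mul, Matrix.det_mul]
      rw [hMd i j, hNd i j]
  inv_mem' := by
    rintro M ⟨hMu, hMd⟩
    refine ⟨fun i => ?_, fun i j => ?_⟩
    · show ((M i)⁻¹ : GL2 ℓ).val 1 0 = 0
      have h1 := hMu i
      unfold IsUpper at h1
      rw [Matrix.coe_units_inv, Matrix.inv_def, Matrix.adjugate_fin_two]
      simp [mat] at h1
      simp [h1]
    · show (((M i)⁻¹ : GL2 ℓ).val).det = (((M j)⁻¹ : GL2 ℓ).val).det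
      rw [Matrix.coe_units_inv, Matrix.coe_units_inv, Matrix.det_nonsing_inv,
        Matrix.det_nonsing_inv]
      rw [show (M i).val.det = (M j).val.det from hMd i j]

/-- `U(ℓ)` as a subgroup of `GL₂(ℤ/ℓℤ)^g`. -/
def Usub (ℓ g : ℕ) : Subgroup (Fin g → GL2 ℓ) where
  carrier := {M | MemU M}
  one_mem' := by
    intro i
    refine ⟨?_, ?_, ?_⟩ <;>
      · show ((1 : GL2 ℓ) : Matrix (Fin 2) (Fin 2) (ZMod ℓ)) _ _ = _
        simp [Matrix.one_apply]
  mul_mem' := by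
    rintro M N hM hN i
    obtain ⟨h1, h2, h3⟩ := hM i
    obtain ⟨k1, k2, k3⟩ := hN i
    simp only [IsUnip, mat] at h1 h2 h3 k1 k2 k3 ⊢
    refine ⟨?_, ?_, ?_⟩ <;>
      · show ((M i * N i : GL2 ℓ) : Matrix (Fin 2) (Fin 2) (ZMod ℓ)) _ _ = _
        rw [Units.val_mul, Matrix.mul_apply, Fin.sum_univ_two]
        simp [h1, h2, h3, k1, k2, k3]
  inv_mem' := by
    rintro M hM i
    obtain ⟨h1, h2, h3⟩ := hM i
    simp only [IsUnip, mat] at h1 h2 h3 ⊢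
    have hdet : ((M i : GL2 ℓ) : Matrix (Fin 2) (Fin 2) (ZMod ℓ)).det = 1 := by
      rw [Matrix.det_fin_two, h1, h2, h3]; ring
    refine ⟨?_, ?_, ?_⟩ <;>
      · show ((M i)⁻¹ : GL2 ℓ).val _ _ = _
        rw [Matrix.coe_units_inv, Matrix.inv_def, Matrix.adjugate_fin_two, hdet]
        simp [h1, h2, h3]

/-- `T(ℓ)` as a subgroup of `GL₂(ℤ/ℓℤ)^g`. -/
def Tsub (ℓ g : ℕ) : Subgroup (Fin g → GL2 ℓ) where
  carrier := {M | MemT M}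
  one_mem' := by
    refine ⟨fun i => ⟨?_, ?_⟩, fun i j => rfl⟩ <;>
      · show ((1 : GL2 ℓ) : Matrix (Fin 2) (Fin 2) (ZMod ℓ)) _ _ = 0
        simp [Matrix.one_apply]
  mul_mem' := by
    rintro M N ⟨hMu, hMd⟩ ⟨hNu, hNd⟩
    refine ⟨fun i => ?_, fun i j => ?_⟩
    · obtain ⟨h1, h2⟩ := hMu i
      obtain ⟨k1, k2⟩ := hNu i
      simp only [IsDiagMat, mat] at h1 h2 k1 k2 ⊢
      constructor <;>
        · show ((M i * N i : GL2 ℓ) : Matrix (Fin 2) (Fin 2) (ZMod ℓ)) _ _ = 0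
          rw [Units.val_mul, Matrix.mul_apply, Fin.sum_univ_two]
          simp [h1, h2, k1, k2]
    · show (mat (M i * N i)).det = (mat (M j * N j)).det
      simp only [mat, Units.val_mul, Matrix.det_mul]
      rw [hMd i j, hNd i j]
  inv_mem' := by
    rintro M ⟨hMu, hMd⟩
    refine ⟨fun i => ?_, fun i j => ?_⟩
    · obtain ⟨h1, h2⟩ := hMu i
      simp only [IsDiagMat, mat] at h1 h2 ⊢
      constructor <;>
        · show ((M i)⁻¹ : GL2 ℓ).val _ _ = 0
          rw [Matrix.coe_units_inv, Matrix.inv_def, Matrix.adjugate_fin_two]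
          simp [h1, h2]
    · show (((M i)⁻¹ : GL2 ℓ).val).det = (((M j)⁻¹ : GL2 ℓ).val).det
      rw [Matrix.coe_units_inv, Matrix.coe_units_inv, Matrix.det_nonsing_inv,
        Matrix.det_nonsing_inv]
      rw [show (M i).val.det = (M j).val.det from hMd i j]

theorem T_le_B (ℓ g : ℕ) : Tsub ℓ g ≤ Bsub ℓ g := by
  rintro M ⟨hMu, hMd⟩
  exact ⟨fun i => (hMu i).1, hMd⟩

/-- `U'(ℓ)` as a subgroup of `GL₂(ℤ/ℓℤ)^g`. -/
def U'sub (ℓ g : ℕ) : Subgroup (Fin g → GL2 ℓ) where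
  carrier := {M | MemU' M}
  one_mem' := by
    refine ⟨1, 1, (Usub ℓ g).one_mem, fun i => ?_⟩
    simp
  mul_mem' := by
    rintro M M' ⟨lam, N, hN, hMN⟩ ⟨mu, P, hP, hMP⟩
    refine ⟨lam * mu, N * P, (Usub ℓ g).mul_mem hN hP, fun i => ?_⟩
    have h1 : ((M i : GL2 ℓ) : Matrix (Fin 2) (Fin 2) (ZMod ℓ))
        = (lam : ZMod ℓ) • ((N i : GL2 ℓ) : Matrix (Fin 2) (Fin 2) (ZMod ℓ)) := hMN i
    have h2 : ((M' i : GL2 ℓ) : Matrix (Fin 2) (Fin 2) (ZMod ℓ))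
        = (mu : ZMod ℓ) • ((P i : GL2 ℓ) : Matrix (Fin 2) (Fin 2) (ZMod ℓ)) := hMP i
    show ((M i * M' i : GL2 ℓ) : Matrix (Fin 2) (Fin 2) (ZMod ℓ))
        = ((lam * mu : (ZMod ℓ)ˣ) : ZMod ℓ) •
          ((N i * P i : GL2 ℓ) : Matrix (Fin 2) (Fin 2) (ZMod ℓ))
    rw [Units.val_mul, Units.val_mul, h1, h2, Units.val_mul,
      smul_mul_assoc, mul_smul_comm, smul_smul]
  inv_mem' := by
    rintro M ⟨lam, N, hN, hMN⟩
    refine ⟨lam⁻¹, N⁻¹, (Usub ℓ g).inv_mem hN, fun i => ?_⟩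
    have h1 : ((M i : GL2 ℓ) : Matrix (Fin 2) (Fin 2) (ZMod ℓ))
        = (lam : ZMod ℓ) • ((N i : GL2 ℓ) : Matrix (Fin 2) (Fin 2) (ZMod ℓ)) := hMN i
    show ((M i)⁻¹ : GL2 ℓ).val
        = ((lam⁻¹ : (ZMod ℓ)ˣ) : ZMod ℓ) • ((N i)⁻¹ : GL2 ℓ).val
    rw [Matrix.coe_units_inv]
    refine Matrix.inv_eq_left_inv ?_
    rw [h1, smul_mul_assoc, mul_smul_comm, smul_smul,
      show ((lam⁻¹ : (ZMod ℓ)ˣ) : ZMod ℓ) * (lam : ZMod ℓ) = 1 from Units.inv_mul lam,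
      show ((N i)⁻¹ : GL2 ℓ).val * ((N i : GL2 ℓ) : Matrix (Fin 2) (Fin 2) (ZMod ℓ)) = 1
        from Units.inv_mul (N i), one_smul]

theorem ncard_image_eq_ncard_image {α β γ : Type*} {p : α → β} {q : α → γ} {S : Set α}
    (h : ∀ x y, p x = p y ↔ q x = q y) : (p '' S).ncard = (q '' S).ncard := by
  refine Set.ncard_congr' (Equiv.ofBijective
    (fun b => ⟨q b.2.choose, b.2.choose, b.2.choose_spec.1, rfl⟩) ⟨fun b c hbc => ?_, ?_⟩)
  · have hp := (h _ _).2 (congrArg Subtype.val hbc)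
    rw [b.2.choose_spec.2, c.2.choose_spec.2] at hp
    exact Subtype.ext hp
  · rintro ⟨_, x, hx, rfl⟩
    have hm : p x ∈ p '' S := ⟨x, hx, rfl⟩
    exact ⟨⟨p x, hm⟩, Subtype.ext ((h _ _).1 hm.choose_spec.2)⟩

/-- If a group acts freely on `p '' S` and the fibres of `q` on `S` are the preimages under `p`
of the orbits, then `p '' S` is `Nat.card Γ` times as large as `q '' S`. -/
theorem card_mul_ncard_image_eq {Γ α β X : Type*} [Group Γ] [MulAction Γ X]
    {p : α → X} {q : α → β} {S : Set α}
    (hfree : ∀ a ∈ S, ∀ γ δ : Γ, γ • p a = δ • p a → γ = δ)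
    (hstable : ∀ a ∈ S, ∀ γ : Γ, ∃ b ∈ S, p b = γ • p a)
    (hq : ∀ a b, q a = q b ↔ ∃ γ : Γ, p b = γ • p a) :
    Nat.card Γ * (q '' S).ncard = (p '' S).ncard := by
  have hrep : ∀ b ∈ q '' S, ∃ a, a ∈ S ∧ q a = b := fun _ hb => hb
  choose s hsS hsq using hrep
  rw [← Nat.card_coe_set_eq, ← Nat.card_coe_set_eq, ← Nat.card_prod]
  refine Nat.card_congr (Equiv.ofBijective
    (fun z : Γ × (q '' S) => (⟨z.1 • p (s z.2 z.2.2), ?_⟩ : p '' S)) ⟨?_, ?_⟩)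
  · obtain ⟨b, hb, hbp⟩ := hstable _ (hsS _ z.2.2) z.1
    exact ⟨b, hb, hbp⟩
  · rintro ⟨γ, b, hb⟩ ⟨δ, c, hc⟩ h
    have h' : γ • p (s b hb) = δ • p (s c hc) := congrArg Subtype.val h
    have hbc : b = c := by
      rw [← hsq b hb, ← hsq c hc, hq]
      exact ⟨δ⁻¹ * γ, by rw [mul_smul, h', inv_smul_smul]⟩
    subst hbc
    rw [hfree _ (hsS b hb) _ _ h']
  · rintro ⟨_, x, hx, rfl⟩
    have hm : q x ∈ q '' S := ⟨x, hx, rfl⟩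
    obtain ⟨γ, hγ⟩ := (hq _ _).1 (hsq _ hm)
    exact ⟨(γ, ⟨q x, hm⟩), Subtype.ext hγ.symm⟩

/-- The condition on the diagonal entries of a tuple of upper triangular matrices for the matrices
to be invertible with equal determinants and total trace zero. -/
def IsTraceZeroDiagonal {K ι : Type*} [Field K] [Fintype ι] (D : ι → K × K) : Prop :=
  (∀ i, (D i).1 ≠ 0 ∧ (D i).2 ≠ 0) ∧ (∀ i j, (D i).1 * (D i).2 = (D j).1 * (D j).2) ∧
    ∑ i, ((D i).1 + (D i).2) = 0

theorem IsTraceZeroDiagonal.eq_cons_swap {K : Type*} [Field K] {n : ℕ} {D E : Fin (n + 1) → K × K}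
    (hD : IsTraceZeroDiagonal D) (hE : IsTraceZeroDiagonal E)
    (hdet : (E 0).1 * (E 0).2 = (D 0).1 * (D 0).2)
    (hfst : ∀ i : Fin n, (E i.succ).1 = (D i.succ).1) (hne : D ≠ E) :
    E = Fin.cons (D 0).swap fun i => D i.succ := by
  obtain ⟨hD0, hDd, hDt⟩ := hD
  obtain ⟨_, hEd, hEt⟩ := hE
  have htail : ∀ i : Fin n, E i.succ = D i.succ := by
    intro i
    refine Prod.ext (hfst i) (mul_left_cancel₀ (hD0 i.succ).1 ?_)
    rw [hDd i.succ 0, ← hdet, ← hEd i.succ 0, hfst i]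
  have htr : (E 0).1 + (E 0).2 = (D 0).1 + (D 0).2 := by
    rw [Fin.sum_univ_succ] at hDt hEt
    simp only [htail] at hEt
    exact add_right_cancel (hEt.trans hDt.symm)
  have hprod : ((E 0).1 - (D 0).1) * ((E 0).1 - (D 0).2) = 0 := by
    linear_combination (E 0).1 * htr - hdet
  have hhead : E 0 = (D 0).swap := by
    rcases mul_eq_zero.1 hprod with h | h
    · refine absurd (_root_.funext fun i => ?_) hne
      refine Fin.cases (Prod.ext ?_ ?_) (fun i => (htail i).symm) i
      · linear_combination -h
      · linear_combination h - htr
    · refine Prod.ext ?_ ?_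
      · simp only [Prod.fst_swap]
        linear_combination h
      · simp only [Prod.snd_swap]
        linear_combination htr - h
  exact _root_.funext fun i => Fin.cases hhead (fun i => htail i) i

theorem ncard_isTraceZeroDiagonal_le {K : Type*} [Field K] [Fintype K] (n : ℕ) :
    {D : Fin (n + 1) → K × K | IsTraceZeroDiagonal D}.ncard ≤
      2 * (Fintype.card K - 1) ^ (n + 1) := by
  classical
  rw [Set.ncard_eq_toFinset_card']
  have hcard : (Fintype.piFinset fun _ : Fin (n + 1) => Finset.univ.erase (0 : K)).card =
      (Fintype.card K - 1) ^ (n + 1) := by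
    simp [Fintype.card_piFinset, Finset.card_erase_of_mem]
  rw [← hcard]
  refine Finset.card_le_mul_card_image_of_maps_to
    (f := fun D => Fin.cons ((D 0).1 * (D 0).2) fun i : Fin n => (D i.succ).1) ?_ 2 ?_
  · intro D hD
    have hD' : IsTraceZeroDiagonal D := by simpa using hD
    rw [Fintype.mem_piFinset]
    intro i
    refine Fin.cases ?_ (fun i => ?_) i
    · simpa using hD'.1 0
    · simpa using (hD'.1 i.succ).1
  · intro v _
    by_contra! hlt
    obtain ⟨D, hD, E, hE, F, hF, hDE, hDF, hEF⟩ := Finset.two_lt_card.1 hlt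
    simp only [Finset.mem_filter, Set.mem_toFinset, Set.mem_ofPred_eq] at hD hE hF
    have hcons : ∀ E', IsTraceZeroDiagonal E' ∧ Fin.cons ((E' 0).1 * (E' 0).2)
        (fun i : Fin n => (E' i.succ).1) = v → D ≠ E' →
        E' = Fin.cons (D 0).swap fun i => D i.succ := fun E' hE' hne => by
      have hv := Fin.cons_inj.1 (hE'.2.trans hD.2.symm)
      exact hD.1.eq_cons_swap hE'.1 hv.1 (congrFun hv.2) hne
    exact hEF ((hcons E hE hDE).trans (hcons F hF hDF).symm)

/-- The diagonal entries of the components of a tuple of matrices. -/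
def diagEntries {ℓ g : ℕ} (M : Fin g → GL2 ℓ) (i : Fin g) : ZMod ℓ × ZMod ℓ :=
  (mat (M i) 0 0, mat (M i) 1 1)

theorem IsUpper.det_eq {ℓ : ℕ} {M : GL2 ℓ} (hM : IsUpper M) :
    (mat M).det = mat M 0 0 * mat M 1 1 := by
  rw [Matrix.det_fin_two, show mat M 1 0 = 0 from hM, mul_zero, sub_zero]

theorem IsUpper.diag_ne_zero {ℓ : ℕ} [Fact ℓ.Prime] {M : GL2 ℓ} (hM : IsUpper M) :
    mat M 0 0 ≠ 0 ∧ mat M 1 1 ≠ 0 := by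
  rw [← mul_ne_zero_iff, ← hM.det_eq]
  exact ((Matrix.isUnit_iff_isUnit_det _).1 M.isUnit).ne_zero

theorem IsUpper.inv_mul_entries_iff {ℓ : ℕ} [Fact ℓ.Prime] {M P : GL2 ℓ} (hM : IsUpper M)
    (hP : IsUpper P) (c : ZMod ℓ) :
    (mat (M⁻¹ * P) 1 0 = 0 ∧ mat (M⁻¹ * P) 0 0 = c ∧ mat (M⁻¹ * P) 1 1 = c) ↔
      mat P 0 0 = c * mat M 0 0 ∧ mat P 1 1 = c * mat M 1 1 := by
  obtain ⟨h0, h1⟩ := hM.diag_ne_zero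
  have hM' : mat M 1 0 = 0 := hM
  have hP' : mat P 1 0 = 0 := hP
  have hmul : mat P = mat M * mat (M⁻¹ * P) := by
    rw [← Units.val_mul, mul_inv_cancel_left]
  generalize mat (M⁻¹ * P) = Q at hmul ⊢
  have e10 : mat P 1 0 = mat M 1 0 * Q 0 0 + mat M 1 1 * Q 1 0 := by
    rw [hmul, Matrix.mul_apply, Fin.sum_univ_two]
  have e00 : mat P 0 0 = mat M 0 0 * Q 0 0 + mat M 0 1 * Q 1 0 := by
    rw [hmul, Matrix.mul_apply, Fin.sum_univ_two]
  have e11 : mat P 1 1 = mat M 1 0 * Q 0 1 + mat M 1 1 * Q 1 1 := by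
    rw [hmul, Matrix.mul_apply, Fin.sum_univ_two]
  have hQ : Q 1 0 = 0 := by simpa [hP', hM', h1] using e10
  rw [e00, e11, hQ, hM', mul_zero, add_zero, zero_mul, zero_add, mul_comm c, mul_comm c,
    mul_right_inj' h0, mul_right_inj' h1]
  simp

theorem memU'_iff {ℓ g : ℕ} {M : Fin g → GL2 ℓ} :
    MemU' M ↔ ∃ c : (ZMod ℓ)ˣ, ∀ i,
      mat (M i) 1 0 = 0 ∧ mat (M i) 0 0 = c ∧ mat (M i) 1 1 = c := by
  refine exists_congr fun c => ⟨?_, fun h => ⟨fun i => c⁻¹ • M i, fun i => ?_, fun i => ?_⟩⟩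
  · rintro ⟨N, hN, hMN⟩ i
    obtain ⟨h1, h2, h3⟩ := hN i
    simp [hMN i, h1, h2, h3]
  · obtain ⟨h1, h2, h3⟩ := h i
    simp [IsUnip, mat, Units.val_smul, Units.smul_def, h1, h2, h3]
  · simp [mat, Units.val_smul, Units.smul_def, smul_smul]

theorem mk_Usub_eq_iff {ℓ g : ℕ} [Fact ℓ.Prime] [((Usub ℓ g).subgroupOf (Bsub ℓ g)).Normal]
    (x y : Bsub ℓ g) :
    QuotientGroup.mk' ((Usub ℓ g).subgroupOf (Bsub ℓ g)) x = QuotientGroup.mk' _ y ↔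
      diagEntries (x : Fin g → GL2 ℓ) = diagEntries (y : Fin g → GL2 ℓ) := by
  rw [QuotientGroup.mk'_apply, QuotientGroup.mk'_apply, QuotientGroup.eq,
    Subgroup.mem_subgroupOf, funext_iff]
  refine forall_congr' fun i => ((x.2.1 i).inv_mul_entries_iff (y.2.1 i) 1).trans ?_
  rw [one_mul, one_mul, diagEntries, diagEntries, Prod.mk.injEq, eq_comm,
    eq_comm (a := mat _ 1 1)]

theorem mk_U'sub_eq_iff {ℓ g : ℕ} [Fact ℓ.Prime] [((U'sub ℓ g).subgroupOf (Bsub ℓ g)).Normal]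
    (x y : Bsub ℓ g) :
    QuotientGroup.mk' ((U'sub ℓ g).subgroupOf (Bsub ℓ g)) x = QuotientGroup.mk' _ y ↔
      ∃ c : (ZMod ℓ)ˣ, diagEntries (y : Fin g → GL2 ℓ) = c • diagEntries (x : Fin g → GL2 ℓ) := by
  rw [QuotientGroup.mk'_apply, QuotientGroup.mk'_apply, QuotientGroup.eq,
    Subgroup.mem_subgroupOf]
  refine memU'_iff.trans (exists_congr fun c => ?_)
  rw [funext_iff]
  refine forall_congr' fun i => ((x.2.1 i).inv_mul_entries_iff (y.2.1 i) c).trans ?_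
  simp [diagEntries, Prod.ext_iff, Units.smul_def]

theorem smul_mem_Bsub {ℓ g : ℕ} (c : (ZMod ℓ)ˣ) {M : Fin g → GL2 ℓ} (hM : M ∈ Bsub ℓ g) :
    c • M ∈ Bsub ℓ g := by
  refine ⟨fun i => ?_, fun i j => ?_⟩
  · have h : mat (M i) 1 0 = 0 := hM.1 i
    simp [IsUpper, mat, Units.val_smul, h]
  · have h : (mat (M i)).det = (mat (M j)).det := hM.2 i j
    simp only [Pi.smul_apply, mat, Units.val_smul, Units.smul_def, Matrix.det_smul, h]

theorem traceSum_smul {ℓ g : ℕ} (c : (ZMod ℓ)ˣ) (M : Fin g → GL2 ℓ) :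
    traceSum (c • M) = c * traceSum M := by
  simp [traceSum, Units.val_smul, Units.smul_def, Matrix.trace_smul, Finset.mul_sum]

theorem diagEntries_smul {ℓ g : ℕ} (c : (ZMod ℓ)ˣ) (M : Fin g → GL2 ℓ) :
    diagEntries (c • M) = c • diagEntries M := by
  funext i
  simp [diagEntries, Units.val_smul, Units.smul_def]

/-- With `Ĉ_Borel(ℓ,0)` the image of `C_Borel(ℓ,0)` in `B(ℓ)/U(ℓ)` and `Ĉ'_Borel(ℓ,0)`
its image in `B(ℓ)/U'(ℓ)`, one has `(ℓ-1)·|Ĉ'_Borel(ℓ,0)| = |Ĉ_Borel(ℓ,0)|`, and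
consequently `|Ĉ'_Borel(ℓ,0)| ≤ 2(ℓ-1)^{g-1}`. -/
theorem card_image_CBorel_zero (ℓ g : ℕ) (hℓ : ℓ.Prime) (hg : 1 ≤ g)
    [hnU : ((Usub ℓ g).subgroupOf (Bsub ℓ g)).Normal]
    [hnU' : ((U'sub ℓ g).subgroupOf (Bsub ℓ g)).Normal] :
    (ℓ - 1) *
        ((QuotientGroup.mk' ((U'sub ℓ g).subgroupOf (Bsub ℓ g))) ''
          {x : Bsub ℓ g | traceSum (x : Fin g → GL2 ℓ) = 0}).ncard =
      ((QuotientGroup.mk' ((Usub ℓ g).subgroupOf (Bsub ℓ g))) ''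
          {x : Bsub ℓ g | traceSum (x : Fin g → GL2 ℓ) = 0}).ncard ∧
    ((QuotientGroup.mk' ((U'sub ℓ g).subgroupOf (Bsub ℓ g))) ''
          {x : Bsub ℓ g | traceSum (x : Fin g → GL2 ℓ) = 0}).ncard ≤
      2 * (ℓ - 1) ^ (g - 1) := by
  have : Fact ℓ.Prime := ⟨hℓ⟩
  obtain ⟨n, rfl⟩ := Nat.exists_eq_add_of_le' hg
  have hmul : (ℓ - 1) *
        ((QuotientGroup.mk' ((U'sub ℓ (n + 1)).subgroupOf (Bsub ℓ (n + 1)))) ''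
          {x : Bsub ℓ (n + 1) | traceSum (x : Fin (n + 1) → GL2 ℓ) = 0}).ncard =
      ((fun x : Bsub ℓ (n + 1) => diagEntries (x : Fin (n + 1) → GL2 ℓ)) ''
          {x : Bsub ℓ (n + 1) | traceSum (x : Fin (n + 1) → GL2 ℓ) = 0}).ncard := by
    rw [← Nat.totient_prime hℓ, ← ZMod.card_units_eq_totient, ← Nat.card_eq_fintype_card]
    refine card_mul_ncard_image_eq (fun x _ c d h => ?_) (fun x hx c => ?_) mk_U'sub_eq_iff
    · have h' := congrArg Prod.fst (congrFun h 0)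
      exact Units.ext (mul_right_cancel₀ (x.2.1 0).diag_ne_zero.1 h')
    · refine ⟨⟨c • x, smul_mem_Bsub c x.2⟩, ?_, diagEntries_smul c _⟩
      have hx' : traceSum (x : Fin (n + 1) → GL2 ℓ) = 0 := hx
      rw [Set.mem_ofPred_eq, traceSum_smul, hx', mul_zero]
  have hle : ((fun x : Bsub ℓ (n + 1) => diagEntries (x : Fin (n + 1) → GL2 ℓ)) ''
      {x : Bsub ℓ (n + 1) | traceSum (x : Fin (n + 1) → GL2 ℓ) = 0}).ncard ≤
      2 * (ℓ - 1) ^ (n + 1) := by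
    have h := ncard_isTraceZeroDiagonal_le (K := ZMod ℓ) n
    rw [ZMod.card] at h
    refine (Set.ncard_le_ncard ?_ (Set.toFinite _)).trans h
    rintro _ ⟨x, hx, rfl⟩
    refine ⟨fun i => (x.2.1 i).diag_ne_zero, fun i j => ?_, ?_⟩
    · exact (x.2.1 i).det_eq.symm.trans ((x.2.2 i j).trans (x.2.1 j).det_eq)
    · rw [← show traceSum (x : Fin (n + 1) → GL2 ℓ) = 0 from hx]
      exact Finset.sum_congr rfl fun i _ => (Matrix.trace_fin_two _).symm
  refine ⟨hmul.trans (ncard_image_eq_ncard_image mk_Usub_eq_iff).symm, ?_⟩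
  refine Nat.le_of_mul_le_mul_left ?_ (Nat.sub_pos_of_lt hℓ.one_lt)
  rw [hmul, Nat.add_sub_cancel]
  exact hle.trans_eq (by ring)
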